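/- For all nonnegative integers n and k, ĉ_{n,k} = Σ_{j=0}^{k} j! · c(n+1, j+1) · S(k+1, j+1). -/

import Mathlib

/-- Unsigned Stirling numbers of the first kind:
`c(0,0)=1`, `c(n,m)=0` for `m>n` or (`n>0` and `m=0`), and `c(n+1,m)=n*c(n,m)+c(n,m-1)`. -/
def stirling1 : ℕ → ℕ → ℕ
  | 0, 0 => 1
  | 0, _ + 1 => 0
  | _ + 1, 0 => 0
  | n + 1, m + 1 => n * stirling1 n (m + 1) + stirling1 n m

/-- Stirling numbers of the second kind:
`S(0,0)=1`, `S(n,m)=0` for `m>n` or (`n>0` and `m=0`), and `S(n+1,m)=m*S(n,m)+S(n,m-1)`. -/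
def stirling2 : ℕ → ℕ → ℕ
  | 0, 0 => 1
  | 0, _ + 1 => 0
  | _ + 1, 0 => 0
  | n + 1, m + 1 => (m + 1) * stirling2 n (m + 1) + stirling2 n m

/-- Poly-Cauchy numbers of the second kind (negated upper index, unsigned):
`ĉ_{n,k} = Σ_{m=0}^n c(n,m)·(m+1)^k`. -/
def polyCauchy (n k : ℕ) : ℕ := ∑ m ∈ Finset.range (n + 1), stirling1 n m * (m + 1) ^ k

theorem stirling1_eq_zero_of_lt : ∀ {n m : ℕ}, n < m → stirling1 n m = 0
  | 0, 0, h => absurd h (lt_irrefl 0)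
  | 0, _ + 1, _ => rfl
  | _ + 1, 0, h => absurd h (Nat.not_lt_zero _)
  | n + 1, m + 1, h => by
    rw [stirling1, stirling1_eq_zero_of_lt (by omega : n < m + 1),
      stirling1_eq_zero_of_lt (by omega : n < m)]
    simp

theorem stirling2_eq_zero_of_lt : ∀ {n m : ℕ}, n < m → stirling2 n m = 0
  | 0, 0, h => absurd h (lt_irrefl 0)
  | 0, _ + 1, _ => rfl
  | _ + 1, 0, h => absurd h (Nat.not_lt_zero _)
  | n + 1, m + 1, h => by
    rw [stirling2, stirling2_eq_zero_of_lt (by omega : n < m + 1),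
      stirling2_eq_zero_of_lt (by omega : n < m)]
    simp

theorem mul_stirling1_zero_right (n : ℕ) : n * stirling1 n 0 = 0 := by
  cases n <;> simp [stirling1]

theorem sum_stirling1_succ_mul (n : ℕ) (f : ℕ → ℕ) :
    ∑ m ∈ Finset.range (n + 2), stirling1 (n + 1) m * f m =
      n * ∑ m ∈ Finset.range (n + 1), stirling1 n m * f m +
        ∑ m ∈ Finset.range (n + 1), stirling1 n m * f (m + 1) := by
  have shift : n * ∑ m ∈ Finset.range (n + 1), stirling1 n m * f m =
      n * ∑ m ∈ Finset.range (n + 1), stirling1 n (m + 1) * f (m + 1) := by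
    rw [Finset.sum_range_succ', Finset.sum_range_succ,
      stirling1_eq_zero_of_lt n.lt_succ_self, mul_add, ← mul_assoc n (stirling1 n 0),
      mul_stirling1_zero_right]
    simp
  rw [shift, Finset.sum_range_succ', Finset.mul_sum, ← Finset.sum_add_distrib]
  simp only [stirling1, zero_mul, add_zero]
  exact Finset.sum_congr rfl fun m _ => by ring

theorem sum_stirling1_mul_choose (n j : ℕ) :
    ∑ m ∈ Finset.range (n + 1), stirling1 n m * m.choose j = stirling1 (n + 1) (j + 1) := by
  induction n generalizing j with
  | zero => cases j <;> simp [stirling1]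
  | succ n ih =>
    rw [sum_stirling1_succ_mul, stirling1, ih]
    cases j with
    | zero =>
      have h := ih 0
      simp only [Nat.choose_zero_right] at h ⊢
      rw [h, stirling1.eq_3]
      ring
    | succ j =>
      simp only [Nat.choose_succ_succ', mul_add, Finset.sum_add_distrib, ih]
      ring

theorem succ_pow_eq_sum_stirling2 (m k : ℕ) :
    (m + 1) ^ k =
      ∑ j ∈ Finset.range (k + 1), j.factorial * m.choose j * stirling2 (k + 1) (j + 1) := by
  induction k with
  | zero => simp [stirling2]
  | succ k ih =>
    have extend : ∑ j ∈ Finset.range (k + 2),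
          j.factorial * m.choose j * ((j + 1) * stirling2 (k + 1) (j + 1)) =
        ∑ j ∈ Finset.range (k + 1),
          j.factorial * m.choose j * ((j + 1) * stirling2 (k + 1) (j + 1)) := by
      rw [Finset.sum_range_succ, stirling2_eq_zero_of_lt (Nat.lt_succ_self (k + 1))]
      simp
    have shift : ∑ j ∈ Finset.range (k + 2), j.factorial * m.choose j * stirling2 (k + 1) j =
        ∑ j ∈ Finset.range (k + 1),
          (j + 1).factorial * m.choose (j + 1) * stirling2 (k + 1) (j + 1) := by
      rw [Finset.sum_range_succ', stirling2.eq_3, mul_zero, add_zero]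
    simp only [stirling2.eq_4 (k + 1), mul_add (_ * _), Finset.sum_add_distrib]
    rw [extend, shift, pow_succ, ih, Finset.sum_mul, ← Finset.sum_add_distrib]
    refine Finset.sum_congr rfl fun j _ => ?_
    have h := Nat.add_one_mul_choose_eq m j
    rw [Nat.choose_succ_succ'] at h
    rw [Nat.factorial_succ]
    linear_combination (j.factorial * stirling2 (k + 1) (j + 1)) * h

theorem polyCauchy_closed_formula (n k : ℕ) :
    polyCauchy n k = ∑ j ∈ Finset.range (k + 1),
      Nat.factorial j * stirling1 (n + 1) (j + 1) * stirling2 (k + 1) (j + 1) := by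
  simp only [polyCauchy, succ_pow_eq_sum_stirling2, Finset.mul_sum]
  rw [Finset.sum_comm]
  refine Finset.sum_congr rfl fun j _ => ?_
  rw [← sum_stirling1_mul_choose, Finset.mul_sum, Finset.sum_mul]
  exact Finset.sum_congr rfl fun m _ => by ring
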